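/- arXiv:1608.05507 — 2 statements merged into one kernel-verified Lean document; each statement's English description precedes it below -/
import Mathlib

section
/- Let K be a compact group of linear transformations of ℝⁿ. Then every polynomial P on ℝⁿ can be written as a finite sum P = Σ_k i_k h_k where each i_k is a K-invariant polynomial and each h_k is K-harmonic, i.e., S(V*) = I(V*)·H(V*). -/
open Matrix MvPolynomial

noncomputable section

/-- The constant-coefficient differential operator on polynomials associated to
`P ∈ ℂ[x₁,…,xₙ]` (substituting `∂/∂xᵢ` for `xᵢ`). -/
def polyDiffOp {n : ℕ} (P : MvPolynomial (Fin n) ℂ) :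
    Module.End ℂ (MvPolynomial (Fin n) ℂ) :=
  ∑ α ∈ P.support, P.coeff α •
    ((List.finRange n).foldr
      (fun i E => (((pderiv i).toLinearMap : Module.End ℂ (MvPolynomial (Fin n) ℂ)) ^ (α i)) * E) 1)

/-- Action of `g ∈ GL(n,ℝ)` on `S(V)` (polynomials in a basis of `V = ℝⁿ`):
`eᵢ ↦ Σⱼ gⱼᵢ eⱼ`. -/
def symAct {n : ℕ} (g : Matrix.GeneralLinearGroup (Fin n) ℝ)
    (P : MvPolynomial (Fin n) ℂ) : MvPolynomial (Fin n) ℂ :=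
  aeval (fun i => ∑ j, ((((g : Matrix (Fin n) (Fin n) ℝ) j i : ℝ) : ℂ)) •
    (X j : MvPolynomial (Fin n) ℂ)) P

/-- Action of `g ∈ GL(n,ℝ)` on `S(V*)` (polynomial functions on `V = ℝⁿ`):
`(g·P)(x) = P(g⁻¹x)`. -/
def symActDual {n : ℕ} (g : Matrix.GeneralLinearGroup (Fin n) ℝ)
    (P : MvPolynomial (Fin n) ℂ) : MvPolynomial (Fin n) ℂ :=
  aeval (fun i => ∑ j, (((((g⁻¹ : Matrix.GeneralLinearGroup (Fin n) ℝ) :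
    Matrix (Fin n) (Fin n) ℝ) i j : ℝ) : ℂ)) • (X j : MvPolynomial (Fin n) ℂ)) P

abbrev MP (n : ℕ) := MvPolynomial (Fin n) ℂ

/-- derivative as an endomorphism -/
def dEnd {n : ℕ} (i : Fin n) : Module.End ℂ (MP n) := (pderiv i).toLinearMap

lemma dEnd_comm {n : ℕ} (i j : Fin n) : dEnd i * dEnd j = (dEnd j * dEnd i : Module.End ℂ (MP n)) := by
  ext1 s
  ext1
  apply MvPolynomial.ext
  intro m
  simp only [dEnd, LinearMap.comp_apply, Module.End.mul_apply, LinearMap.coe_comp]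
  change coeff m (pderiv i (pderiv j _)) = coeff m (pderiv j (pderiv i _))
  simp only [coeff_pderiv]
  by_cases h : i = j
  · subst h; rfl
  · rw [add_right_comm]
    simp [Finsupp.single_apply, h, Ne.symm h]
    ring

lemma exists_diffHom (n : ℕ) : ∃ D : MP n →ₐ[ℂ] Module.End ℂ (MP n),
    (∀ i, D (X i) = dEnd i) ∧ ∀ P, D P = polyDiffOp P := by
  let s : Set (Module.End ℂ (MP n)) := Set.range (dEnd (n := n))
  have hs : ∀ a ∈ s, ∀ b ∈ s, a * b = b * a := by
    rintro _ ⟨i, rfl⟩ _ ⟨j, rfl⟩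
    exact dEnd_comm i j
  let _ : CommRing (Algebra.adjoin ℂ s) := Algebra.adjoinCommRingOfComm ℂ hs
  let D0 : MP n →ₐ[ℂ] Algebra.adjoin ℂ s :=
    aeval (fun i => (⟨dEnd i, Algebra.subset_adjoin ⟨i, rfl⟩⟩ : Algebra.adjoin ℂ s))
  let D : MP n →ₐ[ℂ] Module.End ℂ (MP n) := (Algebra.adjoin ℂ s).val.comp D0
  have hX : ∀ i, D (X i) = dEnd i := by
    intro i
    simp [D, D0]
  refine ⟨D, hX, ?_⟩
  intro P
  conv_lhs => rw [P.as_sum]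
  rw [map_sum, polyDiffOp]
  refine Finset.sum_congr rfl fun α _ => ?_
  have : monomial α (coeff α P) = coeff α P • ((List.finRange n).map fun i => (X i : MP n) ^ α i).prod := by
    rw [← Fin.prod_univ_def, monomial_eq, smul_eq_C_mul, Finsupp.prod_fintype _ _ (by simp)]
  rw [this, map_smul, map_list_prod, List.map_map]
  congr 1
  generalize List.finRange n = l
  induction l with
  | nil => rfl
  | cons a l ih =>
    rw [List.map_cons, List.prod_cons, ih, List.foldr_cons]
    simp only [Function.comp, map_pow, hX]
    rfl

lemma pdo_add {n : ℕ} (P Q : MP n) : polyDiffOp (P + Q) = polyDiffOp P + polyDiffOp Q := by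
  obtain ⟨D, -, h⟩ := exists_diffHom n
  simp [← h]

lemma pdo_zero {n : ℕ} : polyDiffOp (0 : MP n) = 0 := by
  obtain ⟨D, -, h⟩ := exists_diffHom n
  simp [← h]

lemma pdo_sum {n : ℕ} {ι : Type*} (s : Finset ι) (f : ι → MP n) :
    polyDiffOp (∑ i ∈ s, f i) = ∑ i ∈ s, polyDiffOp (f i) := by
  obtain ⟨D, -, h⟩ := exists_diffHom n
  simp [← h]

lemma pdo_smul {n : ℕ} (c : ℂ) (P : MP n) : polyDiffOp (c • P) = c • polyDiffOp P := by
  obtain ⟨D, -, h⟩ := exists_diffHom n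
  simp [← h]

lemma pdo_mul {n : ℕ} (P Q : MP n) : polyDiffOp (P * Q) = polyDiffOp P * polyDiffOp Q := by
  obtain ⟨D, -, h⟩ := exists_diffHom n
  simp [← h]

lemma pdo_C {n : ℕ} (c : ℂ) (p : MP n) : polyDiffOp (C c : MP n) p = c • p := by
  obtain ⟨D, -, h⟩ := exists_diffHom n
  rw [← h, ← algebraMap_eq, AlgHom.commutes]
  rfl

lemma pdo_X {n : ℕ} (i : Fin n) (p : MP n) : polyDiffOp (X i : MP n) p = pderiv i p := by
  obtain ⟨D, hX, h⟩ := exists_diffHom n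
  rw [← h, hX]
  rfl

/-- multi-index factorial -/
def mfact {n : ℕ} (α : Fin n →₀ ℕ) : ℕ := ∏ i, (α i).factorial

lemma mfact_add {n : ℕ} (α : Fin n →₀ ℕ) (i : Fin n) :
    mfact (α + Finsupp.single i 1) = (α i + 1) * mfact α := by
  unfold mfact
  rw [← Finset.mul_prod_erase _ _ (Finset.mem_univ i),
    ← Finset.mul_prod_erase Finset.univ (fun j => (α j).factorial) (Finset.mem_univ i)]
  rw [← mul_assoc]
  congr 1
  · simp [Nat.factorial_succ]
  · refine Finset.prod_congr rfl fun j hj => ?_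
    have : j ≠ i := Finset.ne_of_mem_erase hj
    simp [Finsupp.single_apply, this.symm]

lemma mfact_pos {n : ℕ} (α : Fin n →₀ ℕ) : 0 < mfact α :=
  Finset.prod_pos fun i _ => Nat.factorial_pos _

/-- Fischer inner product -/
def fip {n : ℕ} (p q : MP n) : ℂ :=
  ∑ α ∈ p.support, (starRingEnd ℂ) (coeff α p) * ((mfact α : ℂ) * coeff α q)

lemma fip_eq {n : ℕ} (p q : MP n) (s : Finset (Fin n →₀ ℕ)) (hs : p.support ⊆ s) :
    fip p q = ∑ α ∈ s, (starRingEnd ℂ) (coeff α p) * ((mfact α : ℂ) * coeff α q) := by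
  refine Finset.sum_subset hs fun α _ h => ?_
  rw [notMem_support_iff.mp h]; simp

lemma fip_add_left {n : ℕ} (p q r : MP n) : fip (p + q) r = fip p r + fip q r := by
  classical
  rw [fip_eq (p + q) r (p.support ∪ q.support) support_add,
    fip_eq p r (p.support ∪ q.support) Finset.subset_union_left,
    fip_eq q r (p.support ∪ q.support) Finset.subset_union_right, ← Finset.sum_add_distrib]
  refine Finset.sum_congr rfl fun α _ => ?_
  simp; ring

lemma fip_smul_left {n : ℕ} (c : ℂ) (p r : MP n) :
    fip (c • p) r = (starRingEnd ℂ) c * fip p r := by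
  rw [fip_eq (c • p) r p.support support_smul, fip, Finset.mul_sum]
  refine Finset.sum_congr rfl fun α _ => ?_
  simp; ring

lemma fip_conj {n : ℕ} (p q : MP n) : (starRingEnd ℂ) (fip q p) = fip p q := by
  classical
  rw [fip_eq q p (p.support ∪ q.support) Finset.subset_union_right,
    fip_eq p q (p.support ∪ q.support) Finset.subset_union_left, map_sum]
  refine Finset.sum_congr rfl fun α _ => ?_
  simp; ring

lemma fip_self {n : ℕ} (p : MP n) :
    fip p p = ((∑ α ∈ p.support, (mfact α : ℝ) * Complex.normSq (coeff α p) : ℝ) : ℂ) := by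
  rw [fip]; push_cast
  refine Finset.sum_congr rfl fun α _ => ?_
  rw [Complex.normSq_eq_conj_mul_self]; ring

lemma fip_definite {n : ℕ} (p : MP n) (h : fip p p = 0) : p = 0 := by
  rw [fip_self, Complex.ofReal_eq_zero, Finset.sum_eq_zero_iff_of_nonneg
    (fun α _ => mul_nonneg (Nat.cast_nonneg _) (Complex.normSq_nonneg _))] at h
  rw [← support_eq_empty, Finset.eq_empty_iff_forall_notMem]
  intro α hα
  have := h α hα
  have h2 : (mfact α : ℝ) ≠ 0 := by exact_mod_cast (mfact_pos α).ne'
  simp only [mul_eq_zero, h2, false_or, Complex.normSq_eq_zero] at this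
  exact mem_support_iff.mp hα this

lemma fip_monomial {n : ℕ} (a : Fin n →₀ ℕ) (c : ℂ) (q : MP n) :
    fip (monomial a c) q = (starRingEnd ℂ) c * ((mfact a : ℂ) * coeff a q) := by
  classical
  rw [fip_eq _ q {a} support_monomial_subset]
  simp

lemma fip_X_mul {n : ℕ} (i : Fin n) (q h : MP n) : fip (X i * q) h = fip q (pderiv i h) := by
  induction q using MvPolynomial.induction_on' with
  | monomial a c =>
    rw [X, monomial_mul, one_mul, add_comm, fip_monomial, fip_monomial, coeff_pderiv, mfact_add]
    push_cast; ring
  | add p q hp hq => rw [mul_add, fip_add_left, hp, hq, fip_add_left]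

lemma fip_add_right {n : ℕ} (p q r : MP n) : fip p (q + r) = fip p q + fip p r := by
  rw [← fip_conj, fip_add_left, map_add, fip_conj, fip_conj]

lemma fip_smul_right {n : ℕ} (c : ℂ) (p q : MP n) : fip p (c • q) = c * fip p q := by
  rw [← fip_conj, fip_smul_left, map_mul, fip_conj, Complex.conj_conj]

lemma fip_mul {n : ℕ} (P q h : MP n) :
    fip (P * q) h = fip q (polyDiffOp (map (starRingEnd ℂ) P) h) := by
  induction P using MvPolynomial.induction_on generalizing q h with
  | C a => rw [map_C, pdo_C, fip_smul_right, ← smul_eq_C_mul, fip_smul_left]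
  | add p r hp hr =>
    rw [add_mul, fip_add_left, hp, hr, map_add, pdo_add, LinearMap.add_apply, fip_add_right]
  | mul_X p i hp =>
    rw [mul_assoc, hp, fip_X_mul, map_mul, map_X, mul_comm, pdo_mul, Module.End.mul_apply, pdo_X]

lemma coeff_pdo_monomial {n : ℕ} (α : Fin n →₀ ℕ) (a : ℂ) (γ : Fin n →₀ ℕ) (h : MP n)
    (h0 : coeff (α + γ) h = 0) : coeff γ (polyDiffOp (monomial α a : MP n) h) = 0 := by
  have h1 : fip (monomial γ 1) (polyDiffOp (monomial α a : MP n) h) = 0 := by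
    have := fip_mul (monomial α ((starRingEnd ℂ) a)) (monomial γ 1) h
    rw [map_monomial, Complex.conj_conj] at this
    rw [← this, monomial_mul, fip_monomial, h0]
    simp
  rw [fip_monomial] at h1
  have h2 : (mfact γ : ℂ) ≠ 0 := by exact_mod_cast (mfact_pos γ).ne'
  simpa [h2] using h1

lemma pdo_homog {n k d : ℕ} {P h : MP n} (hP : P.IsHomogeneous k) (hh : h.IsHomogeneous d)
    {γ : Fin n →₀ ℕ} (hγ : coeff γ (polyDiffOp P h) ≠ 0) : k + γ.degree = d := by
  rw [P.as_sum, pdo_sum, LinearMap.sum_apply, coeff_sum] at hγ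
  obtain ⟨α, hα, h1⟩ := Finset.exists_ne_zero_of_sum_ne_zero hγ
  have h2 : coeff (α + γ) h ≠ 0 := fun h0 => h1 (coeff_pdo_monomial _ _ _ _ h0)
  have h3 : (α + γ).degree = d := by rw [Finsupp.degree_eq_weight_one]; exact hh h2
  have h4 : α.degree = k := by
    rw [Finsupp.degree_eq_weight_one]; exact hP (mem_support_iff.mp hα)
  rw [← h3, map_add, h4]

/-- linear substitution -/
def lsub {n : ℕ} (M : Matrix (Fin n) (Fin n) ℝ) : MP n →ₐ[ℂ] MP n :=
  aeval (fun i => ∑ j, ((M i j : ℝ) : ℂ) • (X j : MP n))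

lemma lsub_X {n : ℕ} (M : Matrix (Fin n) (Fin n) ℝ) (i : Fin n) :
    lsub M (X i) = ∑ j, ((M i j : ℝ) : ℂ) • (X j : MP n) := by simp [lsub]

lemma lsub_sub {n : ℕ} (M N : Matrix (Fin n) (Fin n) ℝ) (p : MP n) :
    lsub M (lsub N p) = lsub (N * M) p := by
  have : (lsub M).comp (lsub N) = lsub (N * M) := by
    ext1 i
    simp only [AlgHom.comp_apply, lsub_X, map_sum, map_smul, Matrix.mul_apply, Finset.smul_sum,
      smul_smul]
    rw [Finset.sum_comm]
    refine Finset.sum_congr rfl fun j _ => ?_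
    push_cast
    rw [Finset.sum_smul]
  rw [← this]; rfl

lemma lsub_one {n : ℕ} (p : MP n) : lsub 1 p = p := by
  have : lsub (1 : Matrix (Fin n) (Fin n) ℝ) = AlgHom.id ℂ _ := by
    ext1 i
    rw [lsub_X, Finset.sum_eq_single i] <;> simp +contextual [Matrix.one_apply, eq_comm]
  rw [this]; rfl

lemma lsub_conj {n : ℕ} (M : Matrix (Fin n) (Fin n) ℝ) (p : MP n) :
    lsub M (map (starRingEnd ℂ) p) = map (starRingEnd ℂ) (lsub M p) := by
  induction p using MvPolynomial.induction_on with
  | C a => simp [lsub]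
  | add p q hp hq => simp [hp, hq]
  | mul_X p i hp =>
    rw [map_mul, map_mul, hp, map_mul, map_mul, map_X, lsub_X, map_sum]
    simp [smul_eq_C_mul]

lemma lsub_homog {n k : ℕ} (M : Matrix (Fin n) (Fin n) ℝ) {p : MP n} (hp : p.IsHomogeneous k) :
    (lsub M p).IsHomogeneous k := by
  have := hp.aeval (fun i => ∑ j, ((M i j : ℝ) : ℂ) • (X j : MP n)) (n := 1) (fun i => by
    refine IsHomogeneous.sum _ _ _ fun j _ => ?_
    rw [smul_eq_C_mul]
    exact (isHomogeneous_X _ _).C_mul _)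
  rw [one_mul] at this
  exact this

lemma lsub_comp {n k : ℕ} (M : Matrix (Fin n) (Fin n) ℝ) (p : MP n) :
    homogeneousComponent k (lsub M p) = lsub M (homogeneousComponent k p) := by
  conv_lhs => rw [← sum_homogeneousComponent p, map_sum, map_sum]
  have h : ∀ i, homogeneousComponent k (lsub M (homogeneousComponent i p)) =
      if k = i then lsub M (homogeneousComponent k p) else 0 := by
    intro i
    rw [homogeneousComponent_of_mem
      ((mem_homogeneousSubmodule _ _).2 (lsub_homog M (homogeneousComponent_isHomogeneous i p)))]
    split_ifs <;> simp_all
  simp only [h]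
  rw [Finset.sum_ite_eq]
  split_ifs with hk
  · rfl
  · rw [homogeneousComponent_eq_zero, map_zero]
    simpa using hk

lemma symAct_eq {n : ℕ} (g : Matrix.GeneralLinearGroup (Fin n) ℝ) (p : MP n) :
    symAct g p = lsub (g : Matrix (Fin n) (Fin n) ℝ)ᵀ p := rfl

lemma symActDual_eq {n : ℕ} (g : Matrix.GeneralLinearGroup (Fin n) ℝ) (p : MP n) :
    symActDual g p = lsub ((g⁻¹ : Matrix.GeneralLinearGroup (Fin n) ℝ) :
      Matrix (Fin n) (Fin n) ℝ) p := rfl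

lemma pderiv_lsub {n : ℕ} (A : Matrix (Fin n) (Fin n) ℝ) (j : Fin n) (p : MP n) :
    pderiv j (lsub A p) = lsub A (∑ k, ((A k j : ℝ) : ℂ) • pderiv k p) := by
  induction p using MvPolynomial.induction_on with
  | C a => simp [lsub]
  | add p q hp hq =>
    simp only [map_add, hp, hq, smul_add, Finset.sum_add_distrib]
  | mul_X p i hp =>
    rw [map_mul, pderiv_mul, hp, lsub_X]
    simp only [pderiv_mul, smul_add, Finset.sum_add_distrib, map_add, map_sum, map_smul, map_mul,
      lsub_X]
    congr 1
    · simp only [Finset.sum_mul, smul_mul_assoc]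
    · simp [pderiv_X, Pi.single_apply, Finset.mul_sum, apply_ite, ite_apply]

lemma chain {n : ℕ} (A : Matrix (Fin n) (Fin n) ℝ) (u p : MP n) :
    polyDiffOp u (lsub A p) = lsub A (polyDiffOp (lsub Aᵀ u) p) := by
  induction u using MvPolynomial.induction_on generalizing p with
  | C a => 
    have : lsub Aᵀ (C a) = C a := by simp [lsub]
    rw [this, pdo_C, pdo_C, map_smul]
  | add u v hu hv => simp only [map_add, pdo_add, LinearMap.add_apply, hu, hv]
  | mul_X u i hu =>
    rw [pdo_mul, Module.End.mul_apply, pdo_X, pderiv_lsub, hu, map_mul, pdo_mul,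
      Module.End.mul_apply, lsub_X, pdo_sum]
    simp only [pdo_smul, pdo_X, LinearMap.sum_apply, LinearMap.smul_apply, map_sum, map_smul,
      Matrix.transpose_apply]

lemma exists_proj {F : Type*} [AddCommGroup F] [Module ℂ F] (core : InnerProductSpace.Core ℂ F)
    (W : Submodule ℂ F) [FiniteDimensional ℂ W] (p : F) :
    ∃ w ∈ W, ∀ v ∈ W, core.inner v (p - w) = 0 := by
  letI : NormedAddCommGroup F := core.toNormedAddCommGroup
  letI : InnerProductSpace ℂ F := InnerProductSpace.ofCore core.toCore
  refine ⟨W.starProjection p, W.starProjection_apply_mem p, fun v hv => ?_⟩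
  exact (Submodule.mem_orthogonal W _).1 (W.sub_starProjection_mem_orthogonal p) v hv

open MeasureTheory in
lemma exists_inv {n : ℕ} (K : Subgroup (Matrix.GeneralLinearGroup (Fin n) ℝ))
    (hK : IsCompact (K : Set (Matrix.GeneralLinearGroup (Fin n) ℝ))) :
    ∃ C : Matrix (Fin n) (Fin n) ℝ, C.PosDef ∧
      ∀ g ∈ K, (g : Matrix (Fin n) (Fin n) ℝ) * C * (g : Matrix (Fin n) (Fin n) ℝ)ᵀ = C := by
  haveI : CompactSpace K := isCompact_iff_compactSpace.mp hK
  letI : MeasurableSpace K := borel K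
  haveI : BorelSpace K := ⟨rfl⟩
  let μ : Measure K := Measure.haarMeasure ⊤
  let f : K → Matrix (Fin n) (Fin n) ℝ := fun g =>
    ((g : Matrix.GeneralLinearGroup (Fin n) ℝ) : Matrix (Fin n) (Fin n) ℝ) *
    ((g : Matrix.GeneralLinearGroup (Fin n) ℝ) : Matrix (Fin n) (Fin n) ℝ)ᵀ
  have hc : Continuous f := by
    have : Continuous fun g : K =>
      ((g : Matrix.GeneralLinearGroup (Fin n) ℝ) : Matrix (Fin n) (Fin n) ℝ) :=
      Units.continuous_val.comp continuous_subtype_val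
    exact this.matrix_mul this.matrix_transpose
  have hce : ∀ i j, Continuous fun g => f g i j := fun i j => hc.matrix_elem i j
  have hint : ∀ h : K → ℝ, Continuous h → Integrable h μ := fun h hh =>
    hh.integrable_of_hasCompactSupport (HasCompactSupport.of_compactSpace _)
  let C : Matrix (Fin n) (Fin n) ℝ := fun i j => ∫ g, f g i j ∂μ
  have key : ∀ (a b : Fin n → ℝ), (∑ i, ∑ j, a i * C i j * b j) = ∫ g, (∑ i, ∑ j, a i * f g i j * b j) ∂μ := by
    intro a b
    rw [integral_finsetSum]
    · refine Finset.sum_congr rfl fun i _ => ?_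
      rw [integral_finsetSum]
      · refine Finset.sum_congr rfl fun j _ => ?_
        rw [integral_mul_const, integral_const_mul]
      · intro j _
        exact hint _ ((continuous_const.mul (hce i j)).mul continuous_const)
    · intro i _
      exact hint _ (continuous_finsetSum _ fun j _ =>
        (continuous_const.mul (hce i j)).mul continuous_const)
  have exp : ∀ (A B D : Matrix (Fin n) (Fin n) ℝ) (i j : Fin n),
      (A * B * Dᵀ) i j = ∑ k, ∑ l, A i k * B k l * D j l := by
    intro A B D i j
    simp only [Matrix.mul_apply, Matrix.transpose_apply, Finset.sum_mul]
    rw [Finset.sum_comm]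
  refine ⟨C, ?_, ?_⟩
  · refine Matrix.PosDef.of_dotProduct_mulVec_pos ?_ ?_
    · ext i j
      change (∫ g, f g j i ∂μ) = ∫ g, f g i j ∂μ
      refine integral_congr_ae (Filter.Eventually.of_forall fun g => ?_)
      change f g j i = f g i j
      have : (f g)ᵀ = f g := by simp [f]
      conv_rhs => rw [← this]
      rfl
    · intro v hv
      have e : ∀ M : Matrix (Fin n) (Fin n) ℝ, star v ⬝ᵥ M *ᵥ v = ∑ i, ∑ j, v i * M i j * v j := by
        intro M
        simp [dotProduct, mulVec, Finset.mul_sum, mul_assoc]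
      rw [e, key]
      simp only [← e]
      have hcont : Continuous fun g => star v ⬝ᵥ f g *ᵥ v := by
        simp only [e]
        exact continuous_finsetSum _ fun i _ => continuous_finsetSum _ fun j _ =>
          (continuous_const.mul (hce i j)).mul continuous_const
      have hpos : ∀ g, 0 < star v ⬝ᵥ f g *ᵥ v := by
        intro g
        have hd : (f g).PosDef := by
          have := Matrix.PosDef.mul_conjTranspose_self
            ((g : Matrix.GeneralLinearGroup (Fin n) ℝ) : Matrix (Fin n) (Fin n) ℝ)
            (Matrix.vecMul_injective_of_isUnit (Units.isUnit _))
          simpa [f] using this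
        exact hd.dotProduct_mulVec_pos hv
      exact hcont.integral_pos_of_hasCompactSupport_nonneg_nonzero
        (HasCompactSupport.of_compactSpace _) (fun g => (hpos g).le) (hpos 1).ne'
  · intro g hg
    ext i j
    rw [exp, key]
    simp only [← exp]
    have : ∀ x : K, (g : Matrix (Fin n) (Fin n) ℝ) * f x * (g : Matrix (Fin n) (Fin n) ℝ)ᵀ =
        f (⟨g, hg⟩ * x) := by
      intro x
      simp [f, Matrix.transpose_mul, Matrix.mul_assoc]
    simp only [this]
    exact integral_mul_left_eq_self (fun x => f x i j) (⟨g, hg⟩ : K)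

lemma fip_zero_right {n : ℕ} (p : MP n) : fip p 0 = 0 := by simp [fip]

/-- pulled back inner product -/
def fcore {n : ℕ} (A : Matrix (Fin n) (Fin n) ℝ) (hA : Function.Injective (lsub A)) :
    InnerProductSpace.Core ℂ (MP n) where
  inner p q := fip (lsub A p) (lsub A q)
  conj_inner_symm p q := fip_conj _ _
  re_inner_nonneg p := by
    rw [fip_self]
    exact Finset.sum_nonneg fun α _ => mul_nonneg (Nat.cast_nonneg _) (Complex.normSq_nonneg _)
  add_left p q r := by rw [map_add, fip_add_left]
  smul_left p q r := by rw [map_smul, fip_smul_left]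
  definite p hp := hA (by rw [fip_definite _ hp, map_zero])

lemma finDim_homog (n d : ℕ) : FiniteDimensional ℂ (homogeneousSubmodule (Fin n) ℂ d) := by
  have h : homogeneousSubmodule (Fin n) ℂ d ≤ restrictTotalDegree (Fin n) ℂ d := by
    intro p hp
    rw [mem_restrictTotalDegree]
    exact ((mem_homogeneousSubmodule _ _).1 hp).totalDegree_le
  exact Submodule.finiteDimensional_of_le h

open scoped MatrixOrder in
lemma exists_root {n : ℕ} {M : Matrix (Fin n) (Fin n) ℝ} (hM : M.PosSemidef) :
    ∃ A : Matrix (Fin n) (Fin n) ℝ, M = A * Aᵀ := by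
  obtain ⟨B, hB⟩ := CStarAlgebra.nonneg_iff_eq_star_mul_self.mp hM.nonneg
  refine ⟨Bᵀ, ?_⟩
  rw [hB, Matrix.transpose_transpose, Matrix.star_eq_conjTranspose,
    Matrix.conjTranspose_eq_transpose_of_trivial]

/-- For a compact group `K` of linear transformations of `ℝⁿ`, every
polynomial `P` on `ℝⁿ` is a finite sum `P = Σ iₖ hₖ` with each `iₖ` a `K`-invariant
polynomial and each `hₖ` `K`-harmonic (killed by every `K`-invariant constant-coefficient
differential operator without constant term); that is `S(V*) = I(V*)·H(V*)`. -/
theorem stmt7 (n : ℕ) (K : Subgroup (Matrix.GeneralLinearGroup (Fin n) ℝ))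
    (hK : IsCompact (K : Set (Matrix.GeneralLinearGroup (Fin n) ℝ))) :
    ∀ P : MvPolynomial (Fin n) ℂ,
      P ∈ Submodule.span ℂ
        {q : MvPolynomial (Fin n) ℂ | ∃ i h : MvPolynomial (Fin n) ℂ,
          (∀ g ∈ K, symActDual g i = i) ∧
          (∀ J : MvPolynomial (Fin n) ℂ, (∀ g ∈ K, symAct g J = J) → J.coeff 0 = 0 →
            polyDiffOp J h = 0) ∧
          q = i * h} := by
  obtain ⟨M, hM, hinv⟩ := exists_inv K hK
  obtain ⟨A, hA⟩ := exists_root hM.posSemidef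
  have hMu : IsUnit M.det := hM.det_pos.ne'.isUnit
  have hAu : IsUnit A.det := by
    rw [hA, Matrix.det_mul] at hMu
    exact isUnit_of_mul_isUnit_left hMu
  have hAi : Function.Injective (lsub A) := by
    refine Function.LeftInverse.injective (g := lsub A⁻¹) fun p => ?_
    rw [lsub_sub, Matrix.mul_nonsing_inv _ hAu, lsub_one]
  set S := {q : MvPolynomial (Fin n) ℂ | ∃ i h : MvPolynomial (Fin n) ℂ,
          (∀ g ∈ K, symActDual g i = i) ∧
          (∀ J : MvPolynomial (Fin n) ℂ, (∀ g ∈ K, symAct g J = J) → J.coeff 0 = 0 →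
            polyDiffOp J h = 0) ∧
          q = i * h} with hS
  have hmul : ∀ i : MP n, (∀ g ∈ K, symActDual g i = i) → ∀ q ∈ Submodule.span ℂ S,
      i * q ∈ Submodule.span ℂ S := by
    intro i hi q hq
    induction hq using Submodule.span_induction with
    | mem x hx =>
      obtain ⟨j, h, hj, hh, rfl⟩ := hx
      refine Submodule.subset_span ⟨i * j, h, fun g hg => ?_, hh, (mul_assoc _ _ _).symm⟩
      have h1 := hi g hg
      have h2 := hj g hg
      rw [symActDual_eq] at *
      rw [map_mul, h1, h2]
    | zero => rw [mul_zero]; exact Submodule.zero_mem _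
    | add x y _ _ hx hy => rw [mul_add]; exact Submodule.add_mem _ hx hy
    | smul a x _ hx => rw [mul_smul_comm]; exact Submodule.smul_mem _ _ hx
  have main : ∀ d : ℕ, ∀ p : MP n, p.IsHomogeneous d → p ∈ Submodule.span ℂ S := by
    intro d
    induction d using Nat.strong_induction_on with
    | _ d ih =>
    intro p hp
    let G : Set (MP n) := {r | ∃ (k m : ℕ) (i q : MP n), 0 < k ∧ k + m = d ∧
      i.IsHomogeneous k ∧ q.IsHomogeneous m ∧ (∀ g ∈ K, symActDual g i = i) ∧ r = i * q}
    let W := Submodule.span ℂ G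
    have hWd : W ≤ homogeneousSubmodule (Fin n) ℂ d := by
      refine Submodule.span_le.2 ?_
      rintro _ ⟨k, m, i, q, -, hkm, hi, hq, -, rfl⟩
      have := hi.mul hq
      rw [hkm] at this
      exact this
    have hWS : W ≤ Submodule.span ℂ S := by
      refine Submodule.span_le.2 ?_
      rintro _ ⟨k, m, i, q, hk, hkm, -, hq, hi, rfl⟩
      exact hmul i hi q (ih m (by omega) q hq)
    haveI := finDim_homog n d
    haveI : FiniteDimensional ℂ W := Submodule.finiteDimensional_of_le hWd
    obtain ⟨w, hw, hort⟩ := exists_proj (fcore A hAi) W p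
    have hh : (p - w).IsHomogeneous d := hp.sub (hWd hw)
    have hsum : p = w + 1 * (p - w) := by ring
    rw [hsum]
    refine Submodule.add_mem _ (hWS hw) (Submodule.subset_span ⟨1, p - w, ?_, ?_, rfl⟩)
    · intro g _
      rw [symActDual_eq, map_one]
    · generalize p - w = h at hh hort
      intro J hJ hJ0
      rw [← sum_homogeneousComponent J, pdo_sum, LinearMap.sum_apply]
      refine Finset.sum_eq_zero fun k _ => ?_
      rcases Nat.eq_zero_or_pos k with rfl | hk
      · rw [homogeneousComponent_zero, hJ0, C_0, pdo_zero, LinearMap.zero_apply]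
      have hJk : ∀ g ∈ K, symAct g (homogeneousComponent k J) = homogeneousComponent k J := by
        intro g hg
        have := hJ g hg
        rw [symAct_eq] at *
        rw [← lsub_comp, this]
      have hhom := homogeneousComponent_isHomogeneous k J
      generalize homogeneousComponent k J = L at hJk hhom
      by_contra hne
      obtain ⟨γ, hγ⟩ := ne_zero_iff.1 hne
      have hkd := pdo_homog hhom hh hγ
      have hq : (polyDiffOp L h).IsHomogeneous (d - k) := by
        intro δ hδ
        have := pdo_homog hhom hh hδ
        have h2 : δ.degree = d - k := by omega
        rw [Finsupp.degree_eq_weight_one] at h2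
        exact h2
      have hi : ∀ g ∈ K, symActDual g (lsub M⁻¹ (map (starRingEnd ℂ) L)) =
          lsub M⁻¹ (map (starRingEnd ℂ) L) := by
        intro g hg
        have h1 : (g : Matrix (Fin n) (Fin n) ℝ)ᵀ * M⁻¹ =
            M⁻¹ * ((g⁻¹ : Matrix.GeneralLinearGroup (Fin n) ℝ) : Matrix (Fin n) (Fin n) ℝ) := by
          have h2 := hinv g hg
          have h3 : ((g⁻¹ : Matrix.GeneralLinearGroup (Fin n) ℝ) : Matrix (Fin n) (Fin n) ℝ) *
            (g : Matrix (Fin n) (Fin n) ℝ) = 1 := Units.inv_mul g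
          have h4 : M * (g : Matrix (Fin n) (Fin n) ℝ)ᵀ =
            ((g⁻¹ : Matrix.GeneralLinearGroup (Fin n) ℝ) : Matrix (Fin n) (Fin n) ℝ) * M := by
            conv_rhs => rw [← h2]
            rw [Matrix.mul_assoc (g : Matrix (Fin n) (Fin n) ℝ), ← Matrix.mul_assoc, h3,
              Matrix.one_mul]
          calc (g : Matrix (Fin n) (Fin n) ℝ)ᵀ * M⁻¹
              = M⁻¹ * (M * (g : Matrix (Fin n) (Fin n) ℝ)ᵀ) * M⁻¹ := by
                rw [← Matrix.mul_assoc, Matrix.nonsing_inv_mul _ hMu, Matrix.one_mul]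
            _ = _ := by
                rw [h4, Matrix.mul_assoc, Matrix.mul_assoc, Matrix.mul_nonsing_inv _ hMu,
                  Matrix.mul_one]
        have h5 := hJk g hg
        rw [symAct_eq] at h5
        rw [symActDual_eq, lsub_sub, ← h1, ← lsub_sub, lsub_conj, h5]
      have hmem : lsub M⁻¹ (map (starRingEnd ℂ) L) * polyDiffOp L h ∈ W :=
        Submodule.subset_span ⟨k, d - k, _, _, hk, by omega,
          lsub_homog _ (hhom.map _), hq, hi, rfl⟩
      have h0 := hort _ hmem
      change fip (lsub A _) (lsub A h) = 0 at h0
      have hid : M⁻¹ * A * Aᵀ = 1 := by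
        rw [Matrix.mul_assoc, ← hA, Matrix.nonsing_inv_mul _ hMu]
      have hcc : map (starRingEnd ℂ) (map (starRingEnd ℂ) L) = L := by
        apply MvPolynomial.ext
        intro m
        rw [coeff_map, coeff_map, Complex.conj_conj]
      rw [map_mul, fip_mul, chain, lsub_sub, ← lsub_conj, lsub_sub, hid, lsub_one, hcc] at h0
      exact hne (hAi (by rw [fip_definite _ h0, map_zero]))
  intro P
  rw [← sum_homogeneousComponent P]
  exact Submodule.sum_mem _ fun k _ => main k _ (homogeneousComponent_isHomogeneous k P)

end
end

section
/- Let K be a finite pseudo-reflection group acting on ℝⁿ. Then the algebra of K-invariant complex polynomials in n variables is generated by n homogeneous elements which are algebraically independent over ℂ. -/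
open Matrix MvPolynomial Polynomial

noncomputable section

/-- `M ∈ O(n)` is a pseudo-reflection: exactly one complex eigenvalue (with
multiplicity) differs from `1`. -/
def IsPseudoReflection {n : ℕ} (M : Matrix.orthogonalGroup (Fin n) ℝ) : Prop :=
  ∃ c : ℂ, c ≠ 1 ∧
    ((M : Matrix (Fin n) (Fin n) ℝ).map (Complex.ofReal)).charpoly
      = (Polynomial.X - Polynomial.C c) * (Polynomial.X - 1) ^ (n - 1)

/-- Action of `g ∈ O(n)` on polynomials: `(g·P)(x) = P(g⁻¹x)`. -/
def orthAct {n : ℕ} (g : Matrix.orthogonalGroup (Fin n) ℝ)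
    (P : MvPolynomial (Fin n) ℂ) : MvPolynomial (Fin n) ℂ :=
  aeval (fun i => ∑ j, (((((g⁻¹ : Matrix.orthogonalGroup (Fin n) ℝ) :
    Matrix (Fin n) (Fin n) ℝ) i j : ℝ) : ℂ)) • (X j : MvPolynomial (Fin n) ℂ)) P


namespace CST

set_option linter.unusedSectionVars false

theorem hc_mul {σ : Type*} {d : ℕ} (p f : MvPolynomial σ ℂ) (hf : f.IsHomogeneous d) (D : ℕ) :
    homogeneousComponent D (p * f) =
      (if d ≤ D then homogeneousComponent (D - d) p else 0) * f := by
  conv_lhs => rw [← sum_homogeneousComponent p]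
  have key : ∀ i, homogeneousComponent D (homogeneousComponent i p * f) =
      if i + d = D then homogeneousComponent i p * f else 0 := by
    intro i
    have := homogeneousComponent_of_mem (m := D) (n := i + d) (p := homogeneousComponent i p * f)
      ((homogeneousComponent_isHomogeneous i p).mul hf)
    rw [this]
    simp only [eq_comm]
  rw [Finset.sum_mul, map_sum]
  simp only [key]
  split_ifs with h
  · have : ∀ i, (i + d = D) ↔ (i = D - d) := fun i => by omega
    simp only [this]
    rw [Finset.sum_ite_eq']
    split_ifs with h2
    · rfl
    · rw [homogeneousComponent_eq_zero, zero_mul]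
      rw [Finset.mem_range] at h2
      omega
  · rw [zero_mul]
    apply Finset.sum_eq_zero
    intro i _
    rw [if_neg (by omega)]

theorem comp_hom {σ : Type*} (p : MvPolynomial σ ℂ) (D d : ℕ) :
    (if d ≤ D then homogeneousComponent (D - d) p else 0).IsHomogeneous (D - d) := by
  split_ifs
  · exact homogeneousComponent_isHomogeneous _ _
  · exact isHomogeneous_zero _ _ _

/-- components of elements of ideals generated by homogeneous elements -/
theorem hc_mem {σ : Type*} (s : Set (MvPolynomial σ ℂ)) (hs : ∀ f ∈ s, ∃ d : ℕ, f.IsHomogeneous d)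
    (P : MvPolynomial σ ℂ) (hP : P ∈ Ideal.span s) (D : ℕ) :
    homogeneousComponent D P ∈ Ideal.span s := by
  induction hP using Submodule.span_induction generalizing D with
  | mem x hx =>
    obtain ⟨d, hd⟩ := hs x hx
    rw [homogeneousComponent_of_mem (m := D) (n := d) hd]
    split_ifs
    · exact Ideal.subset_span hx
    · exact zero_mem _
  | zero => simp
  | add x y _ _ hx hy => rw [map_add]; exact add_mem (hx D) (hy D)
  | smul a x _ hx =>
    rw [smul_eq_mul, mul_comm]
    rw [← sum_homogeneousComponent x, Finset.sum_mul, map_sum]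
    refine sum_mem fun i _ => ?_
    rw [mul_comm, hc_mul _ _ (homogeneousComponent_isHomogeneous i x)]
    exact Ideal.mul_mem_left _ _ (hx i)

/-- homogeneous quotients -/
theorem hom_of_mul {σ : Type*} {d e : ℕ} (L q : MvPolynomial σ ℂ) (hL : L.IsHomogeneous d)
    (hL0 : L ≠ 0) (h : (L * q).IsHomogeneous (e + d)) : q.IsHomogeneous e := by
  have h1 := hc_mul q L hL (e + d)
  rw [mul_comm q L, homogeneousComponent_of_mem (m := e + d) (n := e + d) h, if_pos rfl,
    if_pos (by omega), mul_comm L q, Nat.add_sub_cancel] at h1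
  rw [mul_right_cancel₀ hL0 h1]
  exact homogeneousComponent_isHomogeneous _ _

section act

variable {σ : Type*} [Fintype σ] (G : Type*) [Group G] [Fintype G]
  [MulSemiringAction G (MvPolynomial σ ℂ)] [SMulCommClass G ℂ (MvPolynomial σ ℂ)]

/-- The Hilbert ideal. -/
def hilbI : Ideal (MvPolynomial σ ℂ) :=
  Ideal.span {P | (∀ g : G, g • P = P) ∧ ∃ d : ℕ, 0 < d ∧ P.IsHomogeneous d}

/-- A reflection-like element. -/
def IsRefl (s : G) : Prop :=
  ∃ L : MvPolynomial σ ℂ, L ≠ 0 ∧ L.IsHomogeneous 1 ∧ ∀ P : MvPolynomial σ ℂ, L ∣ s • P - P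

theorem hilbI_stable (g : G) (P : MvPolynomial σ ℂ) (hP : P ∈ hilbI (σ := σ) G) :
    g • P ∈ hilbI (σ := σ) G := by
  induction hP using Submodule.span_induction with
  | mem x hx => rw [hx.1 g]; exact Ideal.subset_span hx
  | zero => simp
  | add x y _ _ hx hy => rw [smul_add]; exact add_mem hx hy
  | smul a x _ hx =>
    rw [smul_eq_mul, smul_mul']
    exact Ideal.mul_mem_left _ _ hx

theorem act_hc (hdeg : ∀ (g : G) (P : MvPolynomial σ ℂ) (d : ℕ), P.IsHomogeneous d →
    (g • P).IsHomogeneous d) (g : G) (P : MvPolynomial σ ℂ) (D : ℕ) :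
    g • homogeneousComponent D P = homogeneousComponent D (g • P) := by
  conv_rhs => rw [← sum_homogeneousComponent P, Finset.smul_sum, map_sum]
  have key : ∀ i, homogeneousComponent D (g • homogeneousComponent i P) =
      if i = D then g • homogeneousComponent i P else 0 := by
    intro i
    rw [homogeneousComponent_of_mem (m := D) (n := i)
      (hdeg g _ _ (homogeneousComponent_isHomogeneous i P))]
    simp only [eq_comm]
  simp only [key]
  rw [Finset.sum_ite_eq']
  split_ifs with h2
  · rfl
  · rw [homogeneousComponent_eq_zero, smul_zero]
    simpa using h2

theorem avg_inv (P : MvPolynomial σ ℂ) (g : G) : g • (∑ h : G, h • P) = ∑ h : G, h • P := by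
  rw [Finset.smul_sum]
  simp only [smul_smul]
  exact Fintype.sum_equiv (Equiv.mulLeft g) _ _ (fun x => rfl)

theorem lemma1 (hdeg : ∀ (g : G) (P : MvPolynomial σ ℂ) (d : ℕ), P.IsHomogeneous d →
    (g • P).IsHomogeneous d)
    (hgen : Subgroup.closure {s : G | IsRefl (σ := σ) G s} = ⊤)
    {ι : Type*} [DecidableEq ι] (T : Finset ι) (r : ι → MvPolynomial σ ℂ)
    (hr : ∀ i ∈ T, ∀ g : G, g • r i = r i) (i₀ : ι) (hi₀ : i₀ ∈ T)
    (hmin : r i₀ ∉ Ideal.span (r '' (T.erase i₀ : Finset ι))) (D : ℕ) :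
    ∀ p : ι → MvPolynomial σ ℂ, (p i₀).IsHomogeneous D → ∑ i ∈ T, p i * r i = 0 →
      p i₀ ∈ hilbI (σ := σ) G := by
  induction D with
  | zero =>
    intro p hp hsum
    rw [← totalDegree_zero_iff_isHomogeneous, totalDegree_eq_zero_iff_eq_C] at hp
    by_cases hc : coeff 0 (p i₀) = 0
    · rw [hp, hc]; simp
    · exfalso
      apply hmin
      rw [← Finset.add_sum_erase _ _ hi₀] at hsum
      have h1 : p i₀ * r i₀ ∈ Ideal.span (r '' (T.erase i₀ : Finset ι)) := by
        rw [eq_neg_of_add_eq_zero_left hsum]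
        refine neg_mem (sum_mem fun i hi => Ideal.mul_mem_left _ _ (Ideal.subset_span ⟨i, ?_, rfl⟩))
        exact_mod_cast hi
      have h2 : r i₀ = MvPolynomial.C (coeff 0 (p i₀))⁻¹ * (p i₀ * r i₀) := by
        rw [hp, ← mul_assoc, ← MvPolynomial.C_mul]
        simp [hc]
      rw [h2]
      exact Ideal.mul_mem_left _ _ h1
  | succ D ih =>
    intro p hp hsum
    have hs : ∀ s : G, IsRefl (σ := σ) G s → s • p i₀ - p i₀ ∈ hilbI (σ := σ) G := by
      rintro s ⟨L, hL0, hL, hdiv⟩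
      choose q hq using fun i => hdiv (p i)
      rw [hq]
      refine Ideal.mul_mem_left _ _ (ih q ?_ ?_)
      · apply hom_of_mul L _ hL hL0
        rw [← hq]
        exact (hdeg s _ _ hp).sub hp
      · apply mul_left_cancel₀ hL0
        rw [mul_zero, Finset.mul_sum]
        simp only [← mul_assoc, ← hq, sub_mul, Finset.sum_sub_distrib]
        rw [hsum, sub_zero]
        have : s • (∑ i ∈ T, p i * r i) = 0 := by rw [hsum, smul_zero]
        rw [Finset.smul_sum] at this
        rw [← this]
        refine Finset.sum_congr rfl fun i hi => ?_
        rw [smul_mul', hr i hi]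
    have hall : ∀ g : G, g • p i₀ - p i₀ ∈ hilbI (σ := σ) G := by
      intro g
      have hg : g ∈ Subgroup.closure {s : G | IsRefl (σ := σ) G s} := by rw [hgen]; trivial
      induction hg using Subgroup.closure_induction with
      | mem x hx => exact hs x hx
      | one => simp
      | mul x y _ _ hx hy =>
        have : (x * y) • p i₀ - p i₀ = x • (y • p i₀ - p i₀) + (x • p i₀ - p i₀) := by
          rw [smul_sub, mul_smul]; ring
        rw [this]
        exact add_mem (hilbI_stable G x _ hy) hx
      | inv x _ hx =>
        have : x⁻¹ • p i₀ - p i₀ = - (x⁻¹ • (x • p i₀ - p i₀)) := by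
          rw [smul_sub, inv_smul_smul]; ring
        rw [this]
        exact neg_mem (hilbI_stable G _ _ hx)
    have h1 : ∑ g : G, g • p i₀ ∈ hilbI (σ := σ) G :=
      Ideal.subset_span ⟨avg_inv G _, D + 1, by omega,
        IsHomogeneous.sum _ _ _ fun g _ => hdeg g _ _ hp⟩
    have h2 : ∑ g : G, (g • p i₀ - p i₀) ∈ hilbI (σ := σ) G := sum_mem fun g _ => hall g
    rw [Finset.sum_sub_distrib, Finset.sum_const, nsmul_eq_mul] at h2
    have h3 := sub_mem h1 h2
    rw [sub_sub_cancel] at h3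
    have h4 := Ideal.mul_mem_left _ (MvPolynomial.C ((Finset.univ : Finset G).card : ℂ)⁻¹) h3
    rw [← mul_assoc, ← map_natCast (MvPolynomial.C : ℂ →+* MvPolynomial σ ℂ), ← MvPolynomial.C_mul, inv_mul_cancel₀ (by simp), MvPolynomial.C_1, one_mul] at h4
    exact h4

end act

section indep

variable {σ : Type*} [Fintype σ] {ι : Type*} [Fintype ι] [DecidableEq ι]

theorem chain_rule (f : ι → MvPolynomial σ ℂ) (h : MvPolynomial ι ℂ) (k : σ) :
    pderiv k (MvPolynomial.aeval f h) =
      ∑ i, MvPolynomial.aeval f (pderiv i h) * pderiv k (f i) := by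
  induction h using MvPolynomial.induction_on with
  | C a => simp
  | add p q hp hq => simp only [map_add, hp, hq, add_mul, Finset.sum_add_distrib]
  | mul_X p j hp =>
    simp only [map_mul, Derivation.leibniz, hp, map_add, smul_eq_mul, add_mul,
      Finset.sum_add_distrib, MvPolynomial.aeval_X]
    congr 1
    · rw [Finset.sum_eq_single j]
      · simp
      · intro b _ hb
        simp [pderiv_X_of_ne hb.symm]
      · simp
    · rw [Finset.mul_sum]
      refine Finset.sum_congr rfl fun i _ => by ring

theorem aeval_hom (f : ι → MvPolynomial σ ℂ) (d : ι → ℕ) (hf : ∀ i, (f i).IsHomogeneous (d i))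
    (h : MvPolynomial ι ℂ) (e : ℕ) (hh : h.IsWeightedHomogeneous d e) :
    (MvPolynomial.aeval f h).IsHomogeneous e := by
  rw [MvPolynomial.aeval_def, MvPolynomial.eval₂_eq']
  refine IsHomogeneous.sum _ _ _ fun m hm => ?_
  have h1 := hh (mem_support_iff.mp hm)
  have h2 : (∏ i, f i ^ m i).IsHomogeneous e := by
    rw [← h1, Finsupp.weight_apply, Finsupp.sum_fintype _ _ (by simp)]
    refine IsHomogeneous.prod _ _ _ fun i _ => ?_
    rw [smul_eq_mul, mul_comm]
    exact (hf i).pow _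
  exact h2.C_mul _

theorem aeval_hc (f : ι → MvPolynomial σ ℂ) (d : ι → ℕ) (hf : ∀ i, (f i).IsHomogeneous (d i))
    (h : MvPolynomial ι ℂ) (e : ℕ) :
    homogeneousComponent e (MvPolynomial.aeval f h) =
      MvPolynomial.aeval f (weightedHomogeneousComponent d e h) := by
  induction h using MvPolynomial.induction_on' with
  | monomial m a =>
    have h1 : (MvPolynomial.monomial m a).IsWeightedHomogeneous d (Finsupp.weight d m) :=
      isWeightedHomogeneous_monomial _ _ _ rfl
    rw [weightedHomogeneousComponent_of_mem (m := e) h1,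
      homogeneousComponent_of_mem (m := e) (aeval_hom f d hf _ _ h1)]
    split_ifs <;> simp
  | add p q hp hq => simp only [map_add, hp, hq]

theorem pderiv_eq_zero_of_lt (d : ι → ℕ) (h : MvPolynomial ι ℂ) (e : ℕ)
    (hh : h.IsWeightedHomogeneous d e) (i : ι) (hi : e < d i) : pderiv i h = 0 := by
  rw [← MvPolynomial.support_sum_monomial_coeff h, map_sum]
  refine Finset.sum_eq_zero fun m hm => ?_
  rw [pderiv_monomial]
  have h1 := hh (mem_support_iff.mp hm)
  have : m i = 0 := by
    by_contra h0
    rw [Finsupp.weight_apply, Finsupp.sum_fintype _ _ (by simp)] at h1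
    have h2 : m i • d i ≤ ∑ i, m i • d i :=
      Finset.single_le_sum (f := fun i => m i • d i) (fun _ _ => Nat.zero_le _) (Finset.mem_univ i)
    rw [h1, smul_eq_mul] at h2
    nlinarith [Nat.pos_of_ne_zero h0]
  simp [this]

theorem exists_min_gen {α R : Type*} [DecidableEq α] [CommRing R] (H : α → R) (T₀ : Finset α) :
    ∃ T ⊆ T₀, Ideal.span (H '' (T : Set α)) = Ideal.span (H '' (T₀ : Set α)) ∧
      ∀ i ∈ T, H i ∉ Ideal.span (H '' (T.erase i : Finset α)) := by
  obtain ⟨T, hT, hmin⟩ := exists_minimal_le_of_wellFoundedLT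
    (fun T : Finset α => Ideal.span (H '' (T : Set α)) = Ideal.span (H '' (T₀ : Set α))) T₀ rfl
  refine ⟨T, hT, hmin.1, fun i hi hmem => ?_⟩
  have h1 : Ideal.span (H '' (T.erase i : Finset α)) = Ideal.span (H '' (T₀ : Set α)) := by
    rw [← hmin.1]
    apply le_antisymm
    · exact Ideal.span_mono (Set.image_mono (by exact_mod_cast Finset.erase_subset _ _))
    · rw [Ideal.span_le]
      rintro _ ⟨j, hj, rfl⟩
      by_cases hji : j = i
      · rw [hji]; exact hmem
      · exact Ideal.subset_span ⟨j, by simpa [hji] using hj, rfl⟩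
  have h2 := hmin.2 h1 (Finset.erase_subset _ _)
  exact (Finset.notMem_erase i T) (h2 hi)

theorem mem_span_image {α R : Type*} [DecidableEq α] [CommRing R] (H : α → R) (T : Finset α) (x : R)
    (hx : x ∈ Ideal.span (H '' (T : Set α))) : ∃ c : α → R, x = ∑ i ∈ T, c i * H i := by
  obtain ⟨c, hc⟩ := (Submodule.mem_span_image_finset_iff_exists_fun R).mp hx
  refine ⟨fun i => if h : i ∈ T then c ⟨i, h⟩ else 0, ?_⟩
  rw [← hc, ← Finset.sum_coe_sort T]
  refine Finset.sum_congr rfl fun i _ => ?_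
  simp

variable (G : Type*) [Group G] [Fintype G]
  [MulSemiringAction G (MvPolynomial σ ℂ)] [SMulCommClass G ℂ (MvPolynomial σ ℂ)]

theorem act_aeval (f : ι → MvPolynomial σ ℂ) (hinv : ∀ i, ∀ g : G, g • f i = f i)
    (h : MvPolynomial ι ℂ) (g : G) : g • MvPolynomial.aeval f h = MvPolynomial.aeval f h := by
  induction h using MvPolynomial.induction_on with
  | C a =>
    rw [MvPolynomial.aeval_C]
    exact smul_algebraMap g a
  | add p q hp hq => simp only [map_add, smul_add, hp, hq]
  | mul_X p j hp => simp only [map_mul, smul_mul', hp, MvPolynomial.aeval_X, hinv]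

theorem indep_hom (hdeg : ∀ (g : G) (P : MvPolynomial σ ℂ) (d : ℕ), P.IsHomogeneous d →
    (g • P).IsHomogeneous d)
    (hgen : Subgroup.closure {s : G | IsRefl (σ := σ) G s} = ⊤)
    (f : ι → MvPolynomial σ ℂ) (d : ι → ℕ) (hd : ∀ i, 0 < d i)
    (hf : ∀ i, (f i).IsHomogeneous (d i)) (hinv : ∀ i, ∀ g : G, g • f i = f i)
    (hspan : hilbI (σ := σ) G = Ideal.span (Set.range f))
    (hmin : ∀ i, f i ∉ Ideal.span (f '' {i}ᶜ)) (e : ℕ) :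
    ∀ h : MvPolynomial ι ℂ, h.IsWeightedHomogeneous d e → MvPolynomial.aeval f h = 0 → h = 0 := by
  induction e using Nat.strong_induction_on with
  | _ e ih =>
  intro h hh h0
  set H : ι → MvPolynomial σ ℂ := fun i => MvPolynomial.aeval f (pderiv i h) with hH
  have hpd : ∀ i, d i ≤ e → (pderiv i h).IsWeightedHomogeneous d (e - d i) := fun i hi =>
    hh.pderiv (by omega)
  have hHhom : ∀ i, d i ≤ e → (H i).IsHomogeneous (e - d i) := fun i hi =>
    aeval_hom f d hf _ _ (hpd i hi)
  have hH0 : ∀ i, e < d i → H i = 0 := fun i hi => by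
    simp only [hH, pderiv_eq_zero_of_lt d h e hh i hi, map_zero]
  by_cases hall : ∀ i, H i = 0
  · have hp0 : ∀ i, pderiv i h = 0 := by
      intro i
      by_cases hi : d i ≤ e
      · exact ih (e - d i) (by have := hd i; omega) _ (hpd i hi) (hall i)
      · exact pderiv_eq_zero_of_lt d h e hh i (by omega)
    have heul := hh.sum_weight_X_mul_pderiv
    simp only [hp0, mul_zero, smul_zero, Finset.sum_const_zero] at heul
    rcases Nat.eq_zero_or_pos e with he | he
    · subst he
      have hC : h = MvPolynomial.C (coeff 0 h) := by
        ext m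
        rw [MvPolynomial.coeff_C]
        split_ifs with hm
        · rw [hm]
        · by_contra hne
          have h1 := hh hne
          rw [Finsupp.weight_apply, Finsupp.sum_fintype _ _ (by simp),
            Finset.sum_eq_zero_iff] at h1
          apply hm
          ext i
          have := h1 i (Finset.mem_univ _)
          have h3 := hd i
          simp only [smul_eq_mul, mul_eq_zero] at this
          simp only [Finsupp.coe_zero, Pi.zero_apply]
          omega
      rw [hC, MvPolynomial.aeval_C] at h0
      rw [hC]
      have : coeff 0 h = 0 := by
        apply MvPolynomial.C_injective σ ℂ
        rw [map_zero]
        exact h0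
      rw [this, map_zero]
    · rw [eq_comm, nsmul_eq_mul, mul_eq_zero] at heul
      rcases heul with h1 | h1
      · exact absurd (by exact_mod_cast h1) he.ne'
      · exact h1
  · exfalso
    obtain ⟨T, -, hT, hTmin⟩ := exists_min_gen H Finset.univ
    have hTne : T.Nonempty := by
      rw [Finset.nonempty_iff_ne_empty]
      rintro rfl
      apply hall
      intro i
      have : H i ∈ Ideal.span (H '' ((Finset.univ : Finset ι) : Set ι)) :=
        Ideal.subset_span ⟨i, by simp, rfl⟩
      rw [← hT] at this
      simpa using this
    obtain ⟨i₀, hi₀⟩ := hTne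
    have hHi₀ : H i₀ ≠ 0 := fun h => hTmin i₀ hi₀ (by rw [h]; exact zero_mem _)
    have hdi₀ : d i₀ ≤ e := by
      by_contra hlt
      exact hHi₀ (hH0 i₀ (by omega))
    have hg : ∀ j, ∃ g : ι → MvPolynomial σ ℂ, H j = ∑ i ∈ T, g i * H i ∧
        (g i₀ = 0 ∨ (d j ≤ d i₀ ∧ (g i₀).IsHomogeneous (d i₀ - d j))) ∧
        (j = i₀ → g i₀ = 1) := by
      intro j
      by_cases hj : j = i₀
      · subst hj
        refine ⟨fun i => if i = j then 1 else 0, ?_, Or.inr ⟨le_rfl, ?_⟩, ?_⟩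
        · simp [hi₀]
        · simpa using isHomogeneous_one _ _
        · simp
      by_cases hdj : d j ≤ e
      · have hmem : H j ∈ Ideal.span (H '' (T : Set ι)) := by
          rw [hT]; exact Ideal.subset_span ⟨j, by simp, rfl⟩
        obtain ⟨c, hc⟩ := mem_span_image H T _ hmem
        refine ⟨fun i => if e - d i ≤ e - d j then
          homogeneousComponent ((e - d j) - (e - d i)) (c i) else 0, ?_, ?_, fun h => absurd h hj⟩
        · have h1 := homogeneousComponent_of_mem (m := e - d j) (hHhom j hdj)
          rw [if_pos rfl] at h1
          rw [← h1, hc, map_sum]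
          refine Finset.sum_congr rfl fun i _ => ?_
          by_cases hdi : d i ≤ e
          · exact hc_mul _ _ (hHhom i hdi) _
          · rw [hH0 i (by omega)]; simp
        · by_cases hle : d j ≤ d i₀
          · right
            refine ⟨hle, ?_⟩
            have := comp_hom (c i₀) (e - d j) (e - d i₀)
            convert this using 1
            omega
          · left
            simp only
            rw [if_neg (by omega)]
      · refine ⟨0, ?_, Or.inl rfl, fun h => absurd h hj⟩
        rw [hH0 j (by omega)]; simp
    choose g hg1 hg2 hg3 using hg
    have hp : ∀ k, ∑ j, g j i₀ * pderiv k (f j) ∈ hilbI (σ := σ) G := by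
      intro k
      refine lemma1 G hdeg hgen T H (fun i _ => act_aeval G f hinv _) i₀ hi₀ (hTmin i₀ hi₀)
        (d i₀ - 1) (fun i => ∑ j, g j i * pderiv k (f j)) ?_ ?_
      · refine IsHomogeneous.sum _ _ _ fun j _ => ?_
        rcases hg2 j with h1 | ⟨h1, h2⟩
        · rw [h1, zero_mul]; exact isHomogeneous_zero _ _ _
        · have := h2.mul ((hf j).pderiv (i := k))
          convert this using 1
          have := hd j
          omega
      · have h1 := chain_rule f h k
        rw [h0, map_zero] at h1
        rw [h1]
        simp only [Finset.sum_mul]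
        rw [Finset.sum_comm]
        refine Finset.sum_congr rfl fun j _ => ?_
        change _ = H j * _
        rw [hg1 j, Finset.sum_mul]
        refine Finset.sum_congr rfl fun i _ => by ring
    rw [hspan] at hp
    choose a ha using fun k => Ideal.mem_span_range_iff_exists_fun.mp (hp k)
    have heuler : ∑ k, MvPolynomial.X k * ∑ j, g j i₀ * pderiv k (f j) =
        ∑ j, g j i₀ * (d j • f j) := by
      simp only [Finset.mul_sum]
      rw [Finset.sum_comm]
      refine Finset.sum_congr rfl fun j _ => ?_
      rw [← (hf j).sum_X_mul_pderiv, Finset.mul_sum]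
      refine Finset.sum_congr rfl fun i _ => by ring
    have heuler2 : ∑ k, MvPolynomial.X k * ∑ j, g j i₀ * pderiv k (f j) =
        ∑ l, (∑ k, MvPolynomial.X k * a k l) * f l := by
      simp only [← ha, Finset.mul_sum, Finset.sum_mul]
      rw [Finset.sum_comm]
      refine Finset.sum_congr rfl fun j _ => Finset.sum_congr rfl fun i _ => by ring
    rw [heuler2, ← Finset.add_sum_erase _ _ (Finset.mem_univ i₀),
      ← Finset.add_sum_erase _ _ (Finset.mem_univ i₀), hg3 i₀ rfl, one_mul] at heuler
    set A := ∑ k, MvPolynomial.X k * a k i₀ with hA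
    have hJ : d i₀ • f i₀ - A * f i₀ ∈ Ideal.span (f '' {i₀}ᶜ) := by
      have : d i₀ • f i₀ - A * f i₀ =
        ∑ x ∈ Finset.univ.erase i₀, (∑ k, MvPolynomial.X k * a k x) * f x -
        ∑ x ∈ Finset.univ.erase i₀, g x i₀ * d x • f x := by
        linear_combination -heuler
      rw [this]
      refine sub_mem (sum_mem fun x hx => ?_) (sum_mem fun x hx => ?_)
      · exact Ideal.mul_mem_left _ _ (Ideal.subset_span ⟨x, by simpa using hx, rfl⟩)
      · rw [nsmul_eq_mul]
        exact Ideal.mul_mem_left _ _ (Ideal.mul_mem_left _ _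
          (Ideal.subset_span ⟨x, by simpa using hx, rfl⟩))
    have hJ2 := hc_mem _ (by rintro _ ⟨i, -, rfl⟩; exact ⟨d i, hf i⟩) _ hJ (d i₀)
    have hA0 : coeff 0 A = 0 := by
      rw [hA, MvPolynomial.coeff_sum]
      refine Finset.sum_eq_zero fun k _ => ?_
      rw [← MvPolynomial.constantCoeff_eq, map_mul, MvPolynomial.constantCoeff_X, zero_mul]
    rw [map_sub, hc_mul _ _ (hf i₀), if_pos le_rfl, Nat.sub_self, homogeneousComponent_zero, hA0,
      map_zero, zero_mul, sub_zero, map_nsmul, homogeneousComponent_of_mem (n := d i₀) (hf i₀),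
      if_pos rfl, nsmul_eq_mul] at hJ2
    apply hmin i₀
    have h4 := Ideal.mul_mem_left _ (MvPolynomial.C (d i₀ : ℂ)⁻¹) hJ2
    rw [← mul_assoc, ← map_natCast (MvPolynomial.C : ℂ →+* MvPolynomial σ ℂ), ← MvPolynomial.C_mul,
      inv_mul_cancel₀ (by have := hd i₀; exact_mod_cast this.ne'), MvPolynomial.C_1, one_mul] at h4
    exact h4

theorem indep (hdeg : ∀ (g : G) (P : MvPolynomial σ ℂ) (d : ℕ), P.IsHomogeneous d →
    (g • P).IsHomogeneous d)
    (hgen : Subgroup.closure {s : G | IsRefl (σ := σ) G s} = ⊤)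
    (f : ι → MvPolynomial σ ℂ) (d : ι → ℕ) (hd : ∀ i, 0 < d i)
    (hf : ∀ i, (f i).IsHomogeneous (d i)) (hinv : ∀ i, ∀ g : G, g • f i = f i)
    (hspan : hilbI (σ := σ) G = Ideal.span (Set.range f))
    (hmin : ∀ i, f i ∉ Ideal.span (f '' {i}ᶜ)) : AlgebraicIndependent ℂ f := by
  rw [algebraicIndependent_iff]
  intro h h0
  ext m
  have h1 := aeval_hc f d hf h (Finsupp.weight d m)
  rw [h0, map_zero] at h1
  have h2 := indep_hom G hdeg hgen f d hd hf hinv hspan hmin _ _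
    (weightedHomogeneousComponent_isWeightedHomogeneous _ _) h1.symm
  have h3 := congrArg (MvPolynomial.coeff m) h2
  rw [coeff_weightedHomogeneousComponent, if_pos rfl] at h3
  exact h3

theorem gens (hdeg : ∀ (g : G) (P : MvPolynomial σ ℂ) (d : ℕ), P.IsHomogeneous d →
    (g • P).IsHomogeneous d)
    (f : ι → MvPolynomial σ ℂ) (d : ι → ℕ) (hd : ∀ i, 0 < d i)
    (hf : ∀ i, (f i).IsHomogeneous (d i)) (hinv : ∀ i, ∀ g : G, g • f i = f i)
    (hspan : hilbI (σ := σ) G = Ideal.span (Set.range f)) (P : MvPolynomial σ ℂ) :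
    (∀ g : G, g • P = P) ↔ P ∈ Algebra.adjoin ℂ (Set.range f) := by
  constructor
  · have hom : ∀ (D : ℕ) (P : MvPolynomial σ ℂ), P.IsHomogeneous D → (∀ g : G, g • P = P) →
        P ∈ Algebra.adjoin ℂ (Set.range f) := by
      intro D
      induction D using Nat.strong_induction_on with
      | _ D ih =>
      intro P hP hG
      rcases Nat.eq_zero_or_pos D with h0 | h0
      · subst h0
        rw [← totalDegree_zero_iff_isHomogeneous, totalDegree_eq_zero_iff_eq_C] at hP
        rw [hP]
        exact Subalgebra.algebraMap_mem _ _
      · have hI : P ∈ hilbI (σ := σ) G := Ideal.subset_span ⟨hG, D, h0, hP⟩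
        rw [hspan] at hI
        obtain ⟨c, hc⟩ := Ideal.mem_span_range_iff_exists_fun.mp hI
        have h1 : ((Fintype.card G : ℂ)) • P = ∑ i, (∑ g : G, g • c i) * f i := by
          have : ∑ g : G, g • P = (Fintype.card G : ℂ) • P := by
            simp only [hG, Finset.sum_const, Finset.card_univ]
            rw [Nat.cast_smul_eq_nsmul]
          rw [← this]
          simp only [Finset.sum_mul]
          rw [Finset.sum_comm]
          refine Finset.sum_congr rfl fun g _ => ?_
          rw [← hc, Finset.smul_sum]
          refine Finset.sum_congr rfl fun i _ => ?_
          rw [smul_mul', hinv]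
        have h2 := congrArg (homogeneousComponent D) h1
        rw [map_smul, homogeneousComponent_of_mem (n := D) hP, if_pos rfl, map_sum] at h2
        have h3 : (Fintype.card G : ℂ) • P ∈ Algebra.adjoin ℂ (Set.range f) := by
          rw [h2]
          refine sum_mem fun i _ => ?_
          rw [hc_mul _ _ (hf i)]
          refine mul_mem ?_ (Algebra.subset_adjoin ⟨i, rfl⟩)
          split_ifs with hle
          · refine ih _ (by have := hd i; omega) _ (homogeneousComponent_isHomogeneous _ _) ?_
            intro g
            rw [act_hc G hdeg, avg_inv]
          · exact zero_mem _
        have h4 := Subalgebra.smul_mem _ h3 (Fintype.card G : ℂ)⁻¹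
        rwa [smul_smul, inv_mul_cancel₀ (by simp), one_smul] at h4
    intro hG
    rw [← sum_homogeneousComponent P]
    refine sum_mem fun i _ => hom i _ (homogeneousComponent_isHomogeneous _ _) fun g => ?_
    rw [act_hc G hdeg, hG]
  · intro hP g
    rw [Algebra.adjoin_range_eq_range_aeval] at hP
    obtain ⟨h, rfl⟩ := hP
    exact act_aeval G f hinv h g

end indep

theorem chevalley (n : ℕ) (G : Type*) [Group G] [Fintype G]
    [MulSemiringAction G (MvPolynomial (Fin n) ℂ)] [SMulCommClass G ℂ (MvPolynomial (Fin n) ℂ)]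
    (hdeg : ∀ (g : G) (P : MvPolynomial (Fin n) ℂ) (d : ℕ), P.IsHomogeneous d →
    (g • P).IsHomogeneous d)
    (hgen : Subgroup.closure {s : G | IsRefl (σ := Fin n) G s} = ⊤) :
    ∃ f : Fin n → MvPolynomial (Fin n) ℂ,
      (∀ i, ∃ d : ℕ, (f i).IsHomogeneous d) ∧
      AlgebraicIndependent ℂ f ∧
      (∀ P : MvPolynomial (Fin n) ℂ,
        (∀ g : G, g • P = P) ↔ P ∈ Algebra.adjoin ℂ (Set.range f)) := by
  classical
  obtain ⟨T₀, hT₀, hspan₀⟩ := (Submodule.fg_span_iff_fg_span_finset_subset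
    {P : MvPolynomial (Fin n) ℂ | (∀ g : G, g • P = P) ∧ ∃ d : ℕ, 0 < d ∧ P.IsHomogeneous d}).mp
    (IsNoetherian.noetherian (R := MvPolynomial (Fin n) ℂ) _)
  obtain ⟨T, hTs, hT, hTmin⟩ := exists_min_gen (id : MvPolynomial (Fin n) ℂ → _) T₀
  let f : T → MvPolynomial (Fin n) ℂ := fun x => x.1
  have hfm : ∀ i, f i ∈ {P : MvPolynomial (Fin n) ℂ | (∀ g : G, g • P = P) ∧
      ∃ d : ℕ, 0 < d ∧ P.IsHomogeneous d} := fun i => hT₀ (hTs i.2)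
  have hrange : Set.range f = (T : Set (MvPolynomial (Fin n) ℂ)) := Subtype.range_coe
  have hspan : hilbI (σ := Fin n) G = Ideal.span (Set.range f) := by
    rw [hrange]
    simp only [Set.image_id] at hT
    rw [hT]
    exact hspan₀
  have hmin : ∀ i, f i ∉ Ideal.span (f '' {i}ᶜ) := by
    intro i
    have := hTmin i.1 i.2
    rw [Set.image_id] at this
    have himg : f '' {i}ᶜ = ((T.erase i.1 : Finset (MvPolynomial (Fin n) ℂ)) :
        Set (MvPolynomial (Fin n) ℂ)) := by
      ext x
      simp only [f, Set.mem_image, Finset.coe_erase]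
      constructor
      · rintro ⟨y, hy, rfl⟩
        exact ⟨y.2, fun h => hy (Subtype.ext h)⟩
      · rintro ⟨h1, h2⟩
        exact ⟨⟨x, h1⟩, fun h => h2 (congrArg Subtype.val h), rfl⟩
    rw [himg]
    exact this
  choose hinv d hd hf using hfm
  have hind := indep G hdeg hgen f d hd hf hinv hspan hmin
  have hg := gens G hdeg f d hd hf hinv hspan
  have : Algebra.IsInvariant (Algebra.adjoin ℂ (Set.range f)) (MvPolynomial (Fin n) ℂ) G :=
    ⟨fun b hb => ⟨⟨b, (hg b).mp hb⟩, rfl⟩⟩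
  have hint : Algebra.IsIntegral (Algebra.adjoin ℂ (Set.range f)) (MvPolynomial (Fin n) ℂ) :=
    Algebra.IsInvariant.isIntegral _ _ G
  have hbas : IsTranscendenceBasis ℂ f :=
    hind.isTranscendenceBasis_iff_isAlgebraic.mpr inferInstance
  have hX : IsTranscendenceBasis ℂ (MvPolynomial.X : Fin n → MvPolynomial (Fin n) ℂ) :=
    IsTranscendenceBasis.mvPolynomial (Fin n) ℂ
  have hcard := hX.lift_cardinalMk_eq hbas
  obtain ⟨e⟩ := Cardinal.lift_mk_eq'.mp hcard
  refine ⟨f ∘ e, fun i => ⟨_, hf (e i)⟩, hind.comp e e.injective, ?_⟩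
  rw [e.surjective.range_comp]
  exact hg


theorem refl_matrix {n : ℕ} (g : Matrix.orthogonalGroup (Fin n) ℝ) (hg : IsPseudoReflection g) :
    ∃ v : Fin n → ℝ, v ≠ 0 ∧ (g : Matrix (Fin n) (Fin n) ℝ) = 1 - (2 : ℝ) • Matrix.vecMulVec v v := by
  obtain ⟨c, hc1, hchar⟩ := hg
  set M : Matrix (Fin n) (Fin n) ℝ := (g : Matrix (Fin n) (Fin n) ℝ) with hM
  have hMM : M * Mᵀ = 1 := (Matrix.mem_orthogonalGroup_iff (Fin n) ℝ).mp g.2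
  have hn : 1 ≤ n := by
    have h1 := congrArg Polynomial.natDegree hchar
    rw [Matrix.charpoly_natDegree_eq_dim, ← Polynomial.C_1, Polynomial.Monic.natDegree_mul
      (Polynomial.monic_X_sub_C c) ((Polynomial.monic_X_sub_C (1 : ℂ)).pow _),
      Polynomial.natDegree_X_sub_C] at h1
    simp at h1
    omega
  have hroots : ((M.map Complex.ofReal).charpoly).roots = c ::ₘ Multiset.replicate (n - 1) 1 := by
    rw [hchar, ← Polynomial.C_1, Polynomial.roots_mul, Polynomial.roots_pow,
      Polynomial.roots_X_sub_C, Polynomial.roots_X_sub_C, Multiset.nsmul_singleton]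
    · rfl
    · exact mul_ne_zero (Polynomial.X_sub_C_ne_zero _) (pow_ne_zero _ (Polynomial.X_sub_C_ne_zero _))
  have hdet := Matrix.det_eq_prod_roots_charpoly (M.map Complex.ofReal)
  have htr := Matrix.trace_eq_sum_roots_charpoly (M.map Complex.ofReal)
  rw [hroots] at hdet htr
  simp only [Multiset.prod_cons, Multiset.prod_replicate, one_pow, mul_one] at hdet
  simp only [Multiset.sum_cons, Multiset.sum_replicate, nsmul_eq_mul, mul_one] at htr
  have hdetM : (M.map Complex.ofReal).det = ((M.det : ℝ) : ℂ) :=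
    (RingHom.map_det Complex.ofRealHom M).symm
  have htrM : (M.map Complex.ofReal).trace = ((M.trace : ℝ) : ℂ) := by
    simp [Matrix.trace]
  have hdet2 : M.det * M.det = 1 := by
    have := congrArg Matrix.det hMM
    rwa [Matrix.det_mul, Matrix.det_transpose, Matrix.det_one] at this
  have hdetneg : M.det = -1 := by
    rcases mul_self_eq_one_iff.mp hdet2 with h | h
    · exfalso; apply hc1; rw [← hdet, hdetM, h]; simp
    · exact h
  have htrace : M.trace = n - 2 := by
    have h1 : c = -1 := by rw [← hdet, hdetM, hdetneg]; simp
    rw [htrM, h1, Nat.cast_sub hn] at htr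
    have h2 : ((M.trace : ℝ) : ℂ) = ((n - 2 : ℝ) : ℂ) := by
      rw [htr]; push_cast; ring
    exact_mod_cast h2
  have hdet1 : (M + 1).det = 0 := by
    have h1 : M + 1 = M * (M + 1)ᵀ := by
      rw [Matrix.transpose_add, Matrix.mul_add, hMM, Matrix.transpose_one, mul_one, add_comm]
    have h2 := congrArg Matrix.det h1
    rw [Matrix.det_mul, Matrix.det_transpose, hdetneg] at h2
    linarith
  obtain ⟨w, hw0, hw⟩ := Matrix.exists_mulVec_eq_zero_iff.mpr hdet1
  have hMw : M *ᵥ w = -w := by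
    rw [Matrix.add_mulVec, Matrix.one_mulVec] at hw
    exact eq_neg_of_add_eq_zero_left hw
  have hww : 0 < w ⬝ᵥ w := by
    rcases (Finset.sum_nonneg (fun i _ => mul_self_nonneg (w i))).lt_or_eq with h | h
    · exact h
    · exact absurd (dotProduct_self_eq_zero.mp h.symm) hw0
  set t : ℝ := (Real.sqrt (w ⬝ᵥ w))⁻¹ with ht
  have htt : t * t * (w ⬝ᵥ w) = 1 := by
    rw [ht, ← mul_inv, Real.mul_self_sqrt hww.le, inv_mul_cancel₀ hww.ne']
  have ht0 : t ≠ 0 := by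
    intro h; rw [h] at htt; simp at htt
  set v : Fin n → ℝ := t • w with hv
  have hvv : v ⬝ᵥ v = 1 := by
    rw [hv, smul_dotProduct, dotProduct_smul, smul_eq_mul, smul_eq_mul, ← mul_assoc, htt]
  have hMv : M *ᵥ v = -v := by
    rw [hv, Matrix.mulVec_smul, hMw, smul_neg]
  refine ⟨v, smul_ne_zero ht0 hw0, ?_⟩
  set V := Matrix.vecMulVec v v with hV
  have hMV : M * V = -V := by
    rw [hV, Matrix.mul_vecMulVec, hMv, Matrix.neg_vecMulVec]
  have hVT : Vᵀ = V := by rw [hV, Matrix.transpose_vecMulVec]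
  have hVV : V * V = V := by
    rw [hV, Matrix.vecMulVec_mul_vecMulVec, hvv, one_smul]
  have hVM : V * Mᵀ = -V := by
    have := congrArg Matrix.transpose hMV
    rwa [Matrix.transpose_mul, Matrix.transpose_neg, hVT] at this
  have htrV : V.trace = 1 := by rw [hV, Matrix.trace_vecMulVec, hvv]
  have hzero : (M - (1 - (2 : ℝ) • V)) * (M - (1 - (2 : ℝ) • V))ᴴ = 2 - M - Mᵀ - (4 : ℝ) • V := by
    rw [Matrix.conjTranspose_eq_transpose_of_trivial, Matrix.transpose_sub, Matrix.transpose_sub,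
      Matrix.transpose_smul, hVT, Matrix.transpose_one]
    simp only [mul_sub, sub_mul, hMM, mul_one, one_mul, Matrix.mul_smul, Matrix.smul_mul, hMV, hVM,
      hVV]
    rw [← one_add_one_eq_two (R := Matrix (Fin n) (Fin n) ℝ)]
    module
  have htr0 : ((M - (1 - (2 : ℝ) • V)) * (M - (1 - (2 : ℝ) • V))ᴴ).trace = 0 := by
    rw [hzero, ← one_add_one_eq_two (R := Matrix (Fin n) (Fin n) ℝ)]
    simp only [Matrix.trace_sub, Matrix.trace_add, Matrix.trace_one, Matrix.trace_transpose,
      Matrix.trace_smul, htrV, htrace, Fintype.card_fin, smul_eq_mul]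
    ring
  exact sub_eq_zero.mp (Matrix.trace_mul_conjTranspose_self_eq_zero_iff.mp htr0)

theorem orthAct_one {n : ℕ} (P : MvPolynomial (Fin n) ℂ) :
    orthAct (1 : Matrix.orthogonalGroup (Fin n) ℝ) P = P := by
  unfold orthAct
  conv_rhs => rw [← MvPolynomial.aeval_X_left_apply P]
  congr 2
  ext1 i
  simp [Matrix.one_apply]

theorem orthAct_mul {n : ℕ} (g h : Matrix.orthogonalGroup (Fin n) ℝ) (P : MvPolynomial (Fin n) ℂ) :
    orthAct (g * h) P = orthAct g (orthAct h P) := by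
  unfold orthAct
  rw [← AlgHom.comp_apply]
  congr 1
  apply MvPolynomial.algHom_ext
  intro i
  simp only [AlgHom.comp_apply, MvPolynomial.aeval_X, map_sum, map_smul, Finset.smul_sum, smul_smul]
  rw [Finset.sum_comm]
  refine Finset.sum_congr rfl fun k _ => ?_
  rw [← Finset.sum_smul]
  congr 1
  rw [_root_.mul_inv_rev]
  simp [Matrix.mul_apply]

/-- The action as an algebra homomorphism. -/
def orthHom {n : ℕ} (g : Matrix.orthogonalGroup (Fin n) ℝ) :
    MvPolynomial (Fin n) ℂ →ₐ[ℂ] MvPolynomial (Fin n) ℂ :=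
  MvPolynomial.aeval (fun i => ∑ j, (((((g⁻¹ : Matrix.orthogonalGroup (Fin n) ℝ) :
    Matrix (Fin n) (Fin n) ℝ) i j : ℝ) : ℂ)) • (MvPolynomial.X j : MvPolynomial (Fin n) ℂ))

/-- The action as an instance. -/
@[reducible] def actK {n : ℕ} (K : Subgroup (Matrix.orthogonalGroup (Fin n) ℝ)) :
    MulSemiringAction K (MvPolynomial (Fin n) ℂ) where
  smul g P := orthAct g.1 P
  one_smul P := orthAct_one P
  mul_smul g h P := orthAct_mul g.1 h.1 P
  smul_zero g := map_zero (orthHom g.1)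
  smul_add g P Q := map_add (orthHom g.1) P Q
  smul_one g := map_one (orthHom g.1)
  smul_mul g P Q := map_mul (orthHom g.1) P Q

theorem refl_dvd {n : ℕ} (g : Matrix.orthogonalGroup (Fin n) ℝ) (hg : IsPseudoReflection g) :
    ∃ L : MvPolynomial (Fin n) ℂ, L ≠ 0 ∧ L.IsHomogeneous 1 ∧
      ∀ P : MvPolynomial (Fin n) ℂ, L ∣ orthAct g P - P := by
  obtain ⟨v, hv0, hv⟩ := refl_matrix g hg
  have hinv : ((g⁻¹ : Matrix.orthogonalGroup (Fin n) ℝ) : Matrix (Fin n) (Fin n) ℝ) =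
      1 - (2 : ℝ) • Matrix.vecMulVec v v := by
    have h1 : ((g⁻¹ : Matrix.orthogonalGroup (Fin n) ℝ) : Matrix (Fin n) (Fin n) ℝ) =
      (g : Matrix (Fin n) (Fin n) ℝ)ᵀ := rfl
    rw [h1, hv, Matrix.transpose_sub, Matrix.transpose_smul, Matrix.transpose_vecMulVec,
      Matrix.transpose_one]
  let L : MvPolynomial (Fin n) ℂ := ∑ j, (v j : ℂ) • MvPolynomial.X j
  have hcoef : ∀ j, MvPolynomial.coeff (Finsupp.single j 1) L = v j := by
    intro j
    simp only [L, MvPolynomial.coeff_sum, MvPolynomial.coeff_smul, smul_eq_mul]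
    rw [Finset.sum_eq_single j]
    · simp
    · intro b _ hb
      rw [MvPolynomial.coeff_X, if_neg (by simpa [Finsupp.single_left_inj] using hb), mul_zero]
    · simp
  refine ⟨L, ?_, ?_, ?_⟩
  · intro h
    apply hv0
    ext j
    have := hcoef j
    rw [h, MvPolynomial.coeff_zero] at this
    exact_mod_cast this.symm
  · refine IsHomogeneous.sum _ _ _ fun j _ => ?_
    rw [MvPolynomial.smul_eq_C_mul]
    exact (isHomogeneous_X _ _).C_mul _
  · have hX : ∀ i, orthAct g (MvPolynomial.X i) = MvPolynomial.X i
        - (2 * v i : ℂ) • L := by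
      intro i
      unfold orthAct
      rw [MvPolynomial.aeval_X, hinv]
      simp only [L, Matrix.sub_apply, Matrix.smul_apply, Matrix.vecMulVec_apply, Matrix.one_apply,
        Complex.ofReal_sub, sub_smul, Finset.sum_sub_distrib, Finset.smul_sum, smul_smul]
      congr 1
      · simp
      · refine Finset.sum_congr rfl fun j _ => ?_
        congr 1
        simp
        ring
    intro P
    induction P using MvPolynomial.induction_on with
    | C a => simp [orthAct, MvPolynomial.algebraMap_eq]
    | add p q hp hq =>
      have : orthAct g (p + q) - (p + q) = (orthAct g p - p) + (orthAct g q - q) := by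
        simp only [orthAct, map_add]; ring
      rw [this]
      exact dvd_add hp hq
    | mul_X p i hp =>
      have : orthAct g (p * MvPolynomial.X i) - p * MvPolynomial.X i =
          (orthAct g p - p) * orthAct g (MvPolynomial.X i) +
            p * (orthAct g (MvPolynomial.X i) - MvPolynomial.X i) := by
        simp only [orthAct, map_mul]; ring
      rw [this]
      refine dvd_add (hp.mul_right _) (Dvd.dvd.mul_left ?_ _)
      rw [hX, sub_sub_cancel_left, MvPolynomial.smul_eq_C_mul]
      exact (dvd_mul_left _ _).neg_right

theorem orthAct_hom {n : ℕ} (g : Matrix.orthogonalGroup (Fin n) ℝ) (P : MvPolynomial (Fin n) ℂ)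
    (d : ℕ) (hP : P.IsHomogeneous d) : (orthAct g P).IsHomogeneous d := by
  unfold orthAct
  have := hP.aeval (S := ℂ) (fun i => ∑ j, (((((g⁻¹ : Matrix.orthogonalGroup (Fin n) ℝ) :
    Matrix (Fin n) (Fin n) ℝ) i j : ℝ) : ℂ)) • (MvPolynomial.X j : MvPolynomial (Fin n) ℂ)) (n := 1)
    (fun i => IsHomogeneous.sum _ _ _ fun j _ => by
      rw [MvPolynomial.smul_eq_C_mul]
      exact (isHomogeneous_X _ _).C_mul _)
  rwa [one_mul] at this

end CST

/-- Chevalley–Shephard–Todd, forward direction: for a finite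
pseudo-reflection group `K` acting on `ℝⁿ`, the algebra `ℂ[x₁,…,xₙ]^K` of `K`-invariant
polynomials is generated by `n` homogeneous, algebraically independent elements. -/
theorem stmt8 (n : ℕ) (K : Subgroup (Matrix.orthogonalGroup (Fin n) ℝ)) [Finite K]
    (hrefl : K = Subgroup.closure
      {g : Matrix.orthogonalGroup (Fin n) ℝ | g ∈ K ∧ IsPseudoReflection g}) :
    ∃ f : Fin n → MvPolynomial (Fin n) ℂ,
      (∀ i, ∃ d : ℕ, (f i).IsHomogeneous d) ∧
      AlgebraicIndependent ℂ f ∧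
      (∀ P : MvPolynomial (Fin n) ℂ,
        (∀ g ∈ K, orthAct g P = P) ↔ P ∈ Algebra.adjoin ℂ (Set.range f)) := by
  classical
  let : Fintype K := Fintype.ofFinite K
  let := CST.actK K
  have : SMulCommClass K ℂ (MvPolynomial (Fin n) ℂ) :=
    ⟨fun g c P => (map_smul (CST.orthHom g.1) c P)⟩
  have hgen : Subgroup.closure {s : K | CST.IsRefl (σ := Fin n) K s} = ⊤ := by
    rw [eq_top_iff]
    rintro ⟨g, hg⟩ -
    have hg' := hg
    rw [hrefl] at hg'
    have key : ∀ x (hx : x ∈ Subgroup.closure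
        {g : Matrix.orthogonalGroup (Fin n) ℝ | g ∈ K ∧ IsPseudoReflection g}),
        ∃ y ∈ Subgroup.closure {s : K | CST.IsRefl (σ := Fin n) K s}, y.1 = x := by
      intro x hx
      induction hx using Subgroup.closure_induction with
      | mem x hx => exact ⟨⟨x, hx.1⟩, Subgroup.subset_closure (CST.refl_dvd x hx.2), rfl⟩
      | one => exact ⟨1, one_mem _, rfl⟩
      | mul x y _ _ hx hy =>
        obtain ⟨a, ha, rfl⟩ := hx
        obtain ⟨b, hb, rfl⟩ := hy
        exact ⟨a * b, mul_mem ha hb, rfl⟩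
      | inv x _ hx =>
        obtain ⟨a, ha, rfl⟩ := hx
        exact ⟨a⁻¹, inv_mem ha, rfl⟩
    obtain ⟨y, hy, hyg⟩ := key g hg'
    have : y = ⟨g, hg⟩ := Subtype.ext hyg
    rw [← this]
    exact hy
  obtain ⟨f, h1, h2, h3⟩ := CST.chevalley n K (fun g P d hP => CST.orthAct_hom g.1 P d hP) hgen
  refine ⟨f, h1, h2, fun P => ?_⟩
  rw [← h3]
  exact ⟨fun h g => h g.1 g.2, fun h g hg => h ⟨g, hg⟩⟩

end
end
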